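/- arXiv:2603.16282 — 3 statements merged into one kernel-verified Lean document; each statement's English description precedes it below -/
import Mathlib

section
/- For every real q, every n ∈ ℕ, and every x > 0, the limit as the real parameter p tends to +∞ of M_n^{(p,q)}(x/p) equals (−1)^n n! L_n^{(q)}(x). -/
open Real Filter

/-- First-class finite orthogonal polynomial `M_n^{(p,q)}` defined via the Rodrigues formula. -/
noncomputable def finiteM (p q : ℝ) (n : ℕ) (x : ℝ) : ℝ :=
  (-1 : ℝ) ^ n * (1 + x) ^ (p + q) * x ^ (-q) *
    iteratedDeriv n (fun y : ℝ => y ^ ((n : ℝ) + q) * (1 + y) ^ ((n : ℝ) - p - q)) x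

/-- Generalized Laguerre polynomial `L_n^{(α)}` via the Rodrigues formula. -/
noncomputable def laguerre (α : ℝ) (n : ℕ) (x : ℝ) : ℝ :=
  x ^ (-α) * Real.exp x / (n.factorial : ℝ) *
    iteratedDeriv n (fun y : ℝ => y ^ ((n : ℝ) + α) * Real.exp (-y)) x

lemma iter_rpow (r x : ℝ) (k : ℕ) :
    iteratedDeriv k (fun y : ℝ => y ^ r) x = (descPochhammer ℝ k).eval r * x ^ (r - k) := by
  rw [iteratedDeriv_eq_iterate]; exact Real.iter_deriv_rpow_const r x k

lemma finiteM_eq (p q : ℝ) (n : ℕ) (x : ℝ) (hx : 0 < x) :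
    finiteM p q n x = (-1 : ℝ) ^ n * ∑ k ∈ Finset.range (n + 1), (n.choose k : ℝ) *
      (descPochhammer ℝ k).eval ((n : ℝ) + q) * (1 + x) ^ k *
      (x ^ (n - k) * (descPochhammer ℝ (n - k)).eval ((n : ℝ) - p - q)) := by
  have h1 : (0 : ℝ) < 1 + x := by linarith
  have key := iteratedDeriv_mul (n := n) (x := x) (f := fun y : ℝ => y ^ ((n : ℝ) + q))
    (g := fun y : ℝ => (1 + y) ^ ((n : ℝ) - p - q))
    (Real.contDiffAt_rpow_const_of_ne hx.ne')
    ((contDiffAt_const.add contDiffAt_id).rpow_const_of_ne h1.ne')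
  unfold finiteM
  change _ * iteratedDeriv n ((fun y : ℝ => y ^ ((n : ℝ) + q)) *
    (fun y : ℝ => (1 + y) ^ ((n : ℝ) - p - q))) x = _
  rw [key, mul_assoc, mul_assoc, Finset.mul_sum, Finset.mul_sum]
  congr 1
  refine Finset.sum_congr rfl fun k hk => ?_
  have hk' : k ≤ n := by simpa [Nat.lt_succ_iff] using hk
  rw [iter_rpow, iteratedDeriv_comp_const_add (n - k) (fun z : ℝ => z ^ ((n : ℝ) - p - q)) 1]
  simp only [iter_rpow]
  have e1 : x ^ (-q) * x ^ ((n : ℝ) + q - k) = x ^ (n - k) := by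
    rw [← Real.rpow_add hx, ← Real.rpow_natCast, Nat.cast_sub hk']; congr 1; ring
  have e2 : (1 + x) ^ (p + q) * (1 + x) ^ ((n : ℝ) - p - q - ((n - k : ℕ) : ℝ)) = (1 + x) ^ k := by
    rw [← Real.rpow_add h1, ← Real.rpow_natCast, Nat.cast_sub hk']; congr 1; ring
  rw [← e1, ← e2]; ring

lemma laguerre_eq (q : ℝ) (n : ℕ) (x : ℝ) (hx : 0 < x) :
    (n.factorial : ℝ) * laguerre q n x = ∑ k ∈ Finset.range (n + 1), (n.choose k : ℝ) *
      (descPochhammer ℝ k).eval ((n : ℝ) + q) * (1 : ℝ) ^ k *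
      (x ^ (n - k) * (-1) ^ (n - k)) := by
  have key := iteratedDeriv_mul (n := n) (x := x) (f := fun y : ℝ => y ^ ((n : ℝ) + q))
    (g := fun y : ℝ => Real.exp (-y))
    (Real.contDiffAt_rpow_const_of_ne hx.ne') contDiffAt_id.neg.exp
  unfold laguerre
  change _ * (_ * iteratedDeriv n ((fun y : ℝ => y ^ ((n : ℝ) + q)) *
    (fun y : ℝ => Real.exp (-y))) x) = _
  have hf : (n.factorial : ℝ) ≠ 0 := by positivity
  rw [key, ← mul_assoc, mul_div_cancel₀ _ hf, Finset.mul_sum]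
  refine Finset.sum_congr rfl fun k hk => ?_
  have hk' : k ≤ n := by simpa [Nat.lt_succ_iff] using hk
  have e3 : iteratedDeriv (n - k) (fun y : ℝ => Real.exp (-y)) x
      = (-1) ^ (n - k) * Real.exp (-x) := by
    have := congrFun (iteratedDeriv_exp_const_mul (n - k) (-1)) x
    simpa using this
  have e1 : x ^ (-q) * x ^ ((n : ℝ) + q - k) = x ^ (n - k) := by
    rw [← Real.rpow_add hx, ← Real.rpow_natCast, Nat.cast_sub hk']; congr 1; ring
  have e2 : Real.exp x * Real.exp (-x) = 1 := by rw [← Real.exp_add]; simp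
  rw [iter_rpow, e3, ← e1, one_pow, ← e2]; ring

lemma poch_tendsto (a x : ℝ) (m : ℕ) :
    Tendsto (fun p : ℝ => (x / p) ^ m * (descPochhammer ℝ m).eval (a - p)) atTop
      (nhds (x ^ m * (-1) ^ m)) := by
  have h : ∀ j : ℕ, Tendsto (fun p : ℝ => x / p * (a - p - j)) atTop (nhds (x * (-1))) := by
    intro j
    have h0 : Tendsto (fun p : ℝ => x * (a - j) / p + x * (-1)) atTop (nhds (0 + x * (-1))) :=
      (tendsto_const_nhds.div_atTop tendsto_id).add tendsto_const_nhds
    rw [zero_add] at h0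
    refine h0.congr' ?_
    filter_upwards [eventually_gt_atTop 0] with p hp
    field_simp
    ring
  have := tendsto_finsetProd (Finset.range m) (fun j _ => h j)
  simp only [Finset.prod_mul_distrib, Finset.prod_const, Finset.card_range] at this
  simpa only [descPochhammer_eval_eq_prod_range] using this

theorem stmt5 (q : ℝ) (n : ℕ) (x : ℝ) (hx : 0 < x) :
    Tendsto (fun p : ℝ => finiteM p q n (x / p)) atTop
      (nhds ((-1 : ℝ) ^ n * (n.factorial : ℝ) * laguerre q n x)) := by
  rw [mul_assoc, laguerre_eq q n x hx]
  have hE : (fun p : ℝ => (-1 : ℝ) ^ n * ∑ k ∈ Finset.range (n + 1), (n.choose k : ℝ) *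
      (descPochhammer ℝ k).eval ((n : ℝ) + q) * (1 + x / p) ^ k *
      ((x / p) ^ (n - k) * (descPochhammer ℝ (n - k)).eval (((n : ℝ) - q) - p)))
      =ᶠ[atTop] (fun p : ℝ => finiteM p q n (x / p)) := by
    filter_upwards [eventually_gt_atTop 0] with p hp
    rw [finiteM_eq p q n (x / p) (by positivity), sub_right_comm]
  refine Tendsto.congr' hE (Tendsto.const_mul _ (tendsto_finsetSum _ fun k _ => ?_))
  refine Tendsto.mul (Tendsto.const_mul _ (Tendsto.pow ?_ k)) (poch_tendsto _ _ _)
  have : Tendsto (fun p : ℝ => 1 + x / p) atTop (nhds (1 + 0)) :=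
    tendsto_const_nhds.add (tendsto_const_nhds.div_atTop tendsto_id)
  simpa using this
end

section
/- Let d ≥ 1 be an integer, μ > −1/2, and m ≤ n natural numbers. Let H be as in the context (homogeneous of degree m and satisfying the ball-type equation with parameter μ), and set u(x,t) = L_{n−m}^{(2m+2μ+d−1)}(t) H(x,t). Then for all (x,t) with t > 0: t(Δ_x u + ∂_t² u) + 2⟨x,∇_x⟩∂_t u − ⟨x,∇_x⟩u + (2μ+d−t)∂_t u = −n u. -/
open Real

/-- Partial derivative in the `i`-th coordinate direction. -/
noncomputable def pdx {d : ℕ} (i : Fin d) (f : (Fin d → ℝ) → ℝ) : (Fin d → ℝ) → ℝ :=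
  fun x => fderiv ℝ f x (Pi.single i 1)

/-- The Laplacian `Δ_x = Σ_i ∂²/∂x_i²` in the `x` variable. -/
noncomputable def lapx {d : ℕ} (f : (Fin d → ℝ) → ℝ) : (Fin d → ℝ) → ℝ :=
  fun x => ∑ i : Fin d, pdx i (pdx i f) x

/-- The operator `⟨x,∇_x⟩ = Σ_i x_i ∂/∂x_i`. -/
noncomputable def xgrad {d : ℕ} (f : (Fin d → ℝ) → ℝ) : (Fin d → ℝ) → ℝ :=
  fun x => ∑ i : Fin d, x i * pdx i f x

lemma euler_aux {d : ℕ} (G : (Fin d → ℝ) → ℝ → ℝ)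
    (hG : Differentiable ℝ (fun z : (Fin d → ℝ) × ℝ => G z.1 z.2)) (m j : ℕ)
    (hh : ∀ c : ℝ, 0 < c → ∀ (x : Fin d → ℝ) (t : ℝ), 0 < t →
      c ^ j * G (c • x) (c * t) = c ^ m * G x t) (x : Fin d → ℝ) (t : ℝ) (ht : 0 < t) :
    xgrad (fun y => G y t) x + t * deriv (G x) t = ((m : ℝ) - j) * G x t := by
  set F := fun z : (Fin d → ℝ) × ℝ => G z.1 z.2 with hF
  set A := fderiv ℝ F (x, t) with hA
  have hFA : HasFDerivAt F A (x, t) := (hG (x, t)).hasFDerivAt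
  have h1 : HasFDerivAt (fun y => G y t) (A.comp (ContinuousLinearMap.inl ℝ _ _)) x := by
    have h0 : HasFDerivAt (fun e : Fin d → ℝ => (e, t))
        (ContinuousLinearMap.inl ℝ (Fin d → ℝ) ℝ) x := hasFDerivAt_prodMk_left x t
    have h := HasFDerivAt.comp (g := F) (f := fun e : Fin d → ℝ => (e, t)) x hFA h0
    exact h
  have h2 : HasDerivAt (G x) (A (0, 1)) t := by
    have h := HasFDerivAt.comp (g := F) t hFA (hasFDerivAt_prodMk_right x t)
    have h' := h.hasDerivAt
    simpa [Function.comp_def, hF] using h'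
  have h3 : xgrad (fun y => G y t) x = A (x, 0) := by
    simp only [xgrad, pdx, h1.fderiv]
    have : x = ∑ i, x i • (Pi.single i (1:ℝ) : Fin d → ℝ) := by
      ext k; simp [Finset.sum_apply, Pi.single_apply]
    conv_rhs => rw [show A (x, 0) = (A.comp (ContinuousLinearMap.inl ℝ _ _)) x by simp, this]
    rw [map_sum]
    simp only [map_smul, smul_eq_mul]
  have h4 : HasDerivAt (fun c : ℝ => G (c • x) (c * t)) (A (x, t)) 1 := by
    have hc : HasDerivAt (fun c : ℝ => (c • x, c * t)) (x, t) 1 := by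
      have a := (hasDerivAt_id (1:ℝ)).smul_const x
      have b := (hasDerivAt_id (1:ℝ)).mul_const t
      simpa using a.prodMk b
    have hFA' : HasFDerivAt F A ((1:ℝ) • x, (1:ℝ) * t) := by simpa using hFA
    exact HasFDerivAt.comp_hasDerivAt (l := F) (1:ℝ) hFA' hc
  have h5 := (hasDerivAt_pow j (1:ℝ)).mul h4
  have h6 := (hasDerivAt_pow m (1:ℝ)).mul_const (G x t)
  have h7 := h5.congr_of_eventuallyEq (f₁ := fun c : ℝ => c ^ m * G x t) (by
    filter_upwards [lt_mem_nhds (zero_lt_one' ℝ)] with c hc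
    simpa using (hh c hc x t ht).symm)
  have h8 := h7.unique h6
  simp at h8
  rw [h3, h2.deriv]
  have h9 : A (x, t) = A (x, 0) + t * A (0, 1) := by
    rw [← smul_eq_mul, ← map_smul, ← map_add]; simp
  linarith

lemma w_ode (a : ℝ) (w : ℝ → ℝ) (hw : w = fun y : ℝ => y ^ a * Real.exp (-y)) :
    (∀ j : ℕ, ∀ y : ℝ, 0 < y → HasDerivAt (iteratedDeriv j w) (iteratedDeriv (j+1) w y) y) ∧
    ∀ j : ℕ, ∀ y : ℝ, 0 < y → y * iteratedDeriv (j+2) w y =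
      (a - j - 1 - y) * iteratedDeriv (j+1) w y - (j+1) * iteratedDeriv j w y := by
  have hd : ∀ j : ℕ, ∀ y : ℝ, 0 < y →
      HasDerivAt (iteratedDeriv j w) (iteratedDeriv (j+1) w y) y := by
    intro j y hy
    rw [iteratedDeriv_succ, hasDerivAt_deriv_iff]
    have hc : ContDiffAt ℝ ((j+1 : ℕ) : WithTop ℕ∞) w y := by
      rw [hw]
      exact (contDiffAt_id.rpow_const_of_ne hy.ne').mul (Real.contDiff_exp.contDiffAt.comp y contDiffAt_id.neg)
    have h := (hc.contDiffWithinAt (s := Set.univ)).differentiableWithinAt_iteratedDerivWithin (m := j)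
      (by exact_mod_cast Nat.lt_succ_self j) (by simpa using uniqueDiffOn_univ)
    rwa [iteratedDerivWithin_univ, differentiableWithinAt_univ] at h
  refine ⟨hd, ?_⟩
  have key : ∀ (f g : ℝ → ℝ) (f' g' y : ℝ), 0 < y → (∀ z, 0 < z → f z = g z) →
      HasDerivAt f f' y → HasDerivAt g g' y → f' = g' := by
    intro f g f' g' y hy h hf hg
    refine hf.unique (hg.congr_of_eventuallyEq ?_)
    filter_upwards [lt_mem_nhds hy] with z hz using h z hz
  intro j
  induction j with
  | zero =>
    have h0 : ∀ z, 0 < z → z * iteratedDeriv 1 w z = (a - z) * iteratedDeriv 0 w z := by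
      intro z hz
      have h1 := hd 0 z hz
      have h2 : HasDerivAt w (a * z ^ (a-1) * Real.exp (-z) + z ^ a * (Real.exp (-z) * (-1))) z := by
        rw [hw]
        exact (Real.hasDerivAt_rpow_const (Or.inl hz.ne')).mul (hasDerivAt_neg z).exp
      simp only [iteratedDeriv_zero] at h1 ⊢
      rw [show iteratedDeriv 1 w z = _ from h1.unique h2, Real.rpow_sub_one hz.ne', hw]
      field_simp
      ring
    intro y hy
    have := key _ _ _ _ y hy h0 ((hasDerivAt_id y).mul (hd 1 y hy))
      (((hasDerivAt_id y).const_sub a).mul (hd 0 y hy))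
    simp at this ⊢
    linarith
  | succ j ih =>
    intro y hy
    have := key _ _ _ _ y hy ih ((hasDerivAt_id y).mul (hd (j+2) y hy))
      ((((hasDerivAt_id y).const_sub (a - j - 1)).mul (hd (j+1) y hy)).sub
        ((hd j y hy).const_mul ((j:ℝ)+1)))
    simp at this
    push_cast
    rw [show j + 1 + 2 = j + 2 + 1 from rfl, show j + 1 + 1 = j + 2 from rfl] at *
    linarith

lemma laguerre_ode (α : ℝ) (k : ℕ) : ∃ L1 L2 : ℝ → ℝ, ∀ t : ℝ, 0 < t →
    HasDerivAt (laguerre α k) (L1 t) t ∧ HasDerivAt L1 (L2 t) t ∧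
    t * L2 t + (α + 1 - t) * L1 t + k * laguerre α k t = 0 := by
  set w := fun y : ℝ => y ^ ((k : ℝ) + α) * Real.exp (-y) with hw
  obtain ⟨hd, ho⟩ := w_ode _ w hw
  set g := fun x : ℝ => x ^ (-α) * Real.exp x / (k.factorial : ℝ) with hg
  set v := iteratedDeriv k w
  set v1 := iteratedDeriv (k+1) w
  set v2 := iteratedDeriv (k+2) w
  have hL : laguerre α k = fun t => g t * v t := rfl
  have hgd : ∀ t, 0 < t → HasDerivAt g ((1 - α / t) * g t) t := by
    intro t ht
    have := ((Real.hasDerivAt_rpow_const (p := -α) (Or.inl ht.ne')).mul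
      (Real.hasDerivAt_exp t)).div_const (k.factorial : ℝ)
    refine this.congr_deriv ?_
    rw [Real.rpow_sub_one ht.ne', hg]
    field_simp
    ring
  refine ⟨fun t => g t * (v1 t + (1 - α / t) * v t),
    fun t => g t * (v2 t + 2 * (1 - α / t) * v1 t + ((1 - α / t)^2 + α / t^2) * v t), ?_⟩
  intro t ht
  have hq : HasDerivAt (fun t : ℝ => 1 - α / t) (α / t^2) t := by
    have := ((hasDerivAt_inv ht.ne').const_mul α).const_sub 1
    simp only [← div_eq_mul_inv] at this
    refine this.congr_deriv ?_
    field_simp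
  refine ⟨?_, ?_, ?_⟩
  · rw [hL]
    refine ((hgd t ht).mul (hd k t ht)).congr_deriv ?_
    simp only [v, v1]; ring
  · refine ((hgd t ht).mul ((hd (k+1) t ht).add (hq.mul (hd k t ht)))).congr_deriv ?_
    simp only [v, v1, v2, Pi.add_apply, Pi.mul_apply]; ring
  · have h := ho k t ht
    have h2 : v2 t = ((k + α - k - 1 - t) * v1 t - (k+1) * v t) / t := by
      rw [eq_div_iff ht.ne']; linarith
    simp only [hL, h2]
    field_simp
    ring

lemma pdx_const_mul {d : ℕ} (i : Fin d) (c : ℝ) (f : (Fin d → ℝ) → ℝ) :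
    pdx i (fun y => c * f y) = fun y => c * pdx i f y := by
  funext x
  have : fderiv ℝ (fun y => c * f y) x = c • fderiv ℝ f x := by
    have h := congrFun (fderiv_const_smul_field (𝕜 := ℝ) (f := f) c) x
    exact h
  simp [pdx, this]

lemma xgrad_const_mul {d : ℕ} (c : ℝ) (f : (Fin d → ℝ) → ℝ) (x : Fin d → ℝ) :
    xgrad (fun y => c * f y) x = c * xgrad f x := by
  simp only [xgrad, pdx_const_mul, Finset.mul_sum]
  exact Finset.sum_congr rfl fun i _ => by ring

lemma lapx_const_mul {d : ℕ} (c : ℝ) (f : (Fin d → ℝ) → ℝ) (x : Fin d → ℝ) :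
    lapx (fun y => c * f y) x = c * lapx f x := by
  simp only [lapx, pdx_const_mul, Finset.mul_sum]

lemma xgrad_add {d : ℕ} (f g : (Fin d → ℝ) → ℝ) (x : Fin d → ℝ)
    (hf : DifferentiableAt ℝ f x) (hg : DifferentiableAt ℝ g x) :
    xgrad (fun y => f y + g y) x = xgrad f x + xgrad g x := by
  simp only [xgrad, pdx, fderiv_fun_add hf hg, add_apply, mul_add,
    Finset.sum_add_distrib]

theorem stmt6 (d : ℕ) (hd : 1 ≤ d) (μ : ℝ) (hμ : -1/2 < μ) (m n : ℕ) (hmn : m ≤ n)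
    (H : (Fin d → ℝ) → ℝ → ℝ)
    (hsmooth : ContDiff ℝ (⊤ : ℕ∞) (fun z : (Fin d → ℝ) × ℝ => H z.1 z.2))
    (hhom : ∀ c : ℝ, 0 < c → ∀ (x : Fin d → ℝ) (t : ℝ), 0 < t →
      H (c • x) (c * t) = c ^ m * H x t)
    (hball : ∀ (x : Fin d → ℝ) (t : ℝ), 0 < t →
      t ^ 2 * lapx (fun y => H y t) x - xgrad (xgrad (fun y => H y t)) x
        - (2 * μ + d - 1) * xgrad (fun y => H y t) x
      = -((m : ℝ) * (m + 2 * μ + d - 1)) * H x t)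
    (u : (Fin d → ℝ) → ℝ → ℝ)
    (hu : ∀ (x : Fin d → ℝ) (t : ℝ),
      u x t = laguerre (2 * (m : ℝ) + 2 * μ + d - 1) (n - m) t * H x t) :
    ∀ (x : Fin d → ℝ) (t : ℝ), 0 < t →
      t * (lapx (fun y => u y t) x + deriv (deriv (u x)) t)
        + 2 * xgrad (fun y => deriv (u y) t) x
        - xgrad (fun y => u y t) x
        + (2 * μ + d - t) * deriv (u x) t
      = -(n : ℝ) * u x t := by
  set α := 2 * (m : ℝ) + 2 * μ + d - 1 with hα
  obtain ⟨k, rfl⟩ := Nat.exists_eq_add_of_le hmn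
  simp only [Nat.add_sub_cancel_left] at hu
  obtain ⟨L1, L2, hL⟩ := laguerre_ode α k
  set L := laguerre α k
  set F := fun z : (Fin d → ℝ) × ℝ => H z.1 z.2 with hF
  have hFd : Differentiable ℝ F := hsmooth.differentiable (by simp)
  -- the `t`-derivative of `H`
  have hHt : ∀ x t, HasDerivAt (H x) (fderiv ℝ F (x, t) (0, 1)) t := by
    intro x t
    have h := HasFDerivAt.comp (g := F) t (hFd (x, t)).hasFDerivAt (hasFDerivAt_prodMk_right x t)
    simpa [Function.comp_def, hF] using h.hasDerivAt
  have hT : ∀ x t, deriv (H x) t = fderiv ℝ F (x, t) (0, 1) := fun x t => (hHt x t).deriv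
  have hGd : Differentiable ℝ (fun z : (Fin d → ℝ) × ℝ => deriv (H z.1) z.2) := by
    simp only [hT]
    have : ContDiff ℝ 1 (fderiv ℝ F) := hsmooth.fderiv_right (by norm_cast)
    have h1 := this.differentiable (by simp)
    intro z
    exact (h1 z).clm_apply (differentiableAt_const _)
  have hsl : ∀ (G : (Fin d → ℝ) → ℝ → ℝ),
      Differentiable ℝ (fun z : (Fin d → ℝ) × ℝ => G z.1 z.2) → ∀ t,
      Differentiable ℝ (fun y => G y t) := fun G hG t =>
    hG.comp (differentiable_id.prodMk (differentiable_const t))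
  have hsr : ∀ (G : (Fin d → ℝ) → ℝ → ℝ),
      Differentiable ℝ (fun z : (Fin d → ℝ) × ℝ => G z.1 z.2) → ∀ x,
      Differentiable ℝ (G x) := fun G hG x =>
    hG.comp ((differentiable_const x).prodMk differentiable_id)
  have hGhom : ∀ c : ℝ, 0 < c → ∀ (x : Fin d → ℝ) (t : ℝ), 0 < t →
      c ^ 1 * deriv (H (c • x)) (c * t) = c ^ m * deriv (H x) t := by
    intro c hc x t ht
    have h1 : HasDerivAt (fun s => H (c • x) (c * s)) (deriv (H (c • x)) (c * t) * c) t := by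
      have a : HasDerivAt (fun s : ℝ => c * s) c t := by
        simpa using (hasDerivAt_id t).const_mul c
      exact HasDerivAt.comp t (hsr H hFd (c • x) (c * t)).hasDerivAt a
    have h2 := (hsr H hFd x t).hasDerivAt.const_mul (c ^ m)
    have h3 := h1.unique (h2.congr_of_eventuallyEq (by
      filter_upwards [lt_mem_nhds ht] with s hs using hhom c hc x s hs))
    linarith
  have E1 : ∀ x t, 0 < t → xgrad (fun y => H y t) x + t * deriv (H x) t = m * H x t := by
    intro x t ht
    simpa using euler_aux H hFd m 0 (by simpa using hhom) x t ht
  have E2 : ∀ x t, 0 < t → xgrad (fun y => deriv (H y) t) x + t * deriv (deriv (H x)) t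
      = (m - 1) * deriv (H x) t := by
    intro x t ht
    simpa using euler_aux (fun x t => deriv (H x) t) hGd m 1 hGhom x t ht
  have U1 : ∀ y t, 0 < t → HasDerivAt (u y) (L1 t * H y t + L t * deriv (H y) t) t := by
    intro y t ht
    rw [show u y = fun t => L t * H y t from funext (hu y)]
    exact (hL t ht).1.mul (hsr H hFd y t).hasDerivAt
  intro x t ht
  have U2 : HasDerivAt (deriv (u x)) ((L2 t * H x t + L1 t * deriv (H x) t) +
      (L1 t * deriv (H x) t + L t * deriv (deriv (H x)) t)) t := by
    have := ((hL t ht).2.1.mul (hsr H hFd x t).hasDerivAt).add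
      ((hL t ht).1.mul (hsr (fun x t => deriv (H x) t) hGd x t).hasDerivAt)
    refine this.congr_of_eventuallyEq ?_
    filter_upwards [lt_mem_nhds ht] with s hs using (U1 x s hs).deriv
  have hX : xgrad (fun y => deriv (u y) t) x =
      L1 t * xgrad (fun y => H y t) x + L t * xgrad (fun y => deriv (H y) t) x := by
    rw [show (fun y => deriv (u y) t) = fun y => L1 t * H y t + L t * deriv (H y) t from
      funext fun y => (U1 y t ht).deriv]
    rw [xgrad_add _ _ _ ((hsl H hFd t x).const_mul _)
      ((hsl (fun x t => deriv (H x) t) hGd t x).const_mul _), xgrad_const_mul, xgrad_const_mul]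
  -- `x`-gradient of the Euler identity
  have E3 : xgrad (xgrad (fun y => H y t)) x =
      m * xgrad (fun y => H y t) x - t * xgrad (fun y => deriv (H y) t) x := by
    rw [show xgrad (fun y => H y t) = fun y => m * H y t + (-t) * deriv (H y) t from
      funext fun y => by linarith [E1 y t ht]]
    rw [xgrad_add _ _ _ ((hsl H hFd t x).const_mul _)
      ((hsl (fun x t => deriv (H x) t) hGd t x).const_mul _), xgrad_const_mul, xgrad_const_mul]
    have := E1 x t ht
    rw [show xgrad (fun y => H y t) x = m * H x t + (-t) * deriv (H x) t by linarith]
    ring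
  rw [hX, U2.deriv, (U1 x t ht).deriv]
  simp only [hu, lapx_const_mul, xgrad_const_mul]
  have hb := hball x t ht
  have e1 := E1 x t ht
  have e2 := E2 x t ht
  have ode := (hL t ht).2.2
  rw [E3] at hb
  generalize xgrad (fun y => H y t) x = X at *
  generalize xgrad (fun y => deriv (H y) t) x = Y at *
  generalize lapx (fun y => H y t) x = Z at *
  generalize deriv (deriv (H x)) t = T2 at *
  generalize deriv (H x) t = T1 at *
  generalize H x t = h at *
  have hX' : X = m * h - t * T1 := by linarith
  have hY : Y = (m - 1) * T1 - t * T2 := by linarith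
  subst hX' hY
  have hZ : t * Z + t * T2 + 2 * ((m - 1) * T1 - t * T2) + (2 * μ + d) * T1 = 0 := by
    have : t * (t * Z + t * T2 + 2 * ((m - 1) * T1 - t * T2) + (2 * μ + d) * T1) = 0 := by
      linear_combination hb
    exact (mul_eq_zero.mp this).resolve_left ht.ne'
  push_cast
  linear_combination h * ode + L t * hZ
end

section
/- Let d ≥ 1 be an integer, μ > −1/2, m ≤ n natural numbers, and p a real number. Let H be as in the context (homogeneous of degree m and satisfying the ball-type equation with parameter μ). Set v(x,t) = N_{n−m}^{(p−2μ−2m−d+1)}(t) H(x,t) and ṽ(x,t) = N_{n−m−1}^{(p−2μ−2m−d−1)}(t) H(x,t), with ṽ interpreted as 0 when n = m. Then for all (x,t) with t > 0: t²∂_t²v + ( 2t⟨x,∇_x⟩ + (1+2μ+d−p)t )∂_t v + (2μ+d−p)⟨x,∇_x⟩v + ⟨x,∇_x⟩²v = n(n+2μ+d−p) v − (n−m)(p−2μ−m−n−d) ṽ. -/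
open Real

/-- Second-class finite orthogonal polynomial `N_n^{(p)}` defined via the Rodrigues formula. -/
noncomputable def finiteN (p : ℝ) (n : ℕ) (x : ℝ) : ℝ :=
  (-1 : ℝ) ^ n * x ^ p * Real.exp (1 / x) *
    iteratedDeriv n (fun y : ℝ => y ^ (2 * (n : ℝ) - p) * Real.exp (-1 / y)) x

/-- The weight derivatives. -/
noncomputable def gW (a : ℝ) (j : ℕ) : ℝ → ℝ :=
  iteratedDeriv j (fun y : ℝ => y ^ a * Real.exp (-1 / y))

lemma gW_hasDerivAt (a : ℝ) (j : ℕ) {t : ℝ} (ht : 0 < t) :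
    HasDerivAt (gW a j) (gW a (j + 1) t) t := by
  have hc : ContDiffAt ℝ ((j + 1 : ℕ) : WithTop ℕ∞)
      (fun y : ℝ => y ^ a * Real.exp (-1 / y)) t := by
    apply ContDiffAt.mul
    · exact contDiffAt_id.rpow_const_of_ne ht.ne'
    · exact (contDiffAt_const.div contDiffAt_id ht.ne').exp
  have h : DifferentiableAt ℝ (iteratedDeriv j (fun y : ℝ => y ^ a * Real.exp (-1 / y))) t := by
    rw [← iteratedDerivWithin_univ]
    exact (ContDiffWithinAt.differentiableWithinAt_iteratedDerivWithin (contDiffWithinAt_univ.2 hc)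
      (by exact_mod_cast Nat.lt_succ_self j) (by simpa using uniqueDiffOn_univ)).differentiableAt
      Filter.univ_mem
  have h2 := h.hasDerivAt
  unfold gW
  rw [iteratedDeriv_succ]
  exact h2

lemma gW_zero (a : ℝ) {t : ℝ} (ht : 0 < t) :
    t ^ 2 * gW a 1 t = (a * t + 1) * gW a 0 t := by
  have h1 := gW_hasDerivAt a 0 ht
  have h2 : HasDerivAt (gW a 0) (a * t ^ (a - 1) * Real.exp (-1 / t) +
      t ^ a * (Real.exp (-1 / t) * (1 / t ^ 2))) t := by
    have e : gW a 0 = fun y : ℝ => y ^ a * Real.exp (-1 / y) := by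
      simp [gW]
    rw [e]
    refine (Real.hasDerivAt_rpow_const (Or.inl ht.ne')).mul (HasDerivAt.exp ?_)
    have := ((hasDerivAt_const t (-1 : ℝ)).div (hasDerivAt_id t) ht.ne')
    exact this.congr_deriv (by simp)
  rw [h1.unique h2]
  have e : gW a 0 t = t ^ a * Real.exp (-1 / t) := by simp [gW]
  rw [e, Real.rpow_sub_one ht.ne']
  field_simp

lemma gW_succ (a : ℝ) (j : ℕ) : ∀ {t : ℝ}, 0 < t →
    t ^ 2 * gW a (j + 2) t + 2 * (j + 1) * t * gW a (j + 1) t + (j + 1) * j * gW a j t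
      = (a * t + 1) * gW a (j + 1) t + (j + 1) * a * gW a j t := by
  induction j with
  | zero =>
    intro t ht
    have hid := hasDerivAt_id t
    have hL := (hid.pow 2).mul (gW_hasDerivAt a 1 ht)
    have hR := ((hid.const_mul a).add_const 1).mul (gW_hasDerivAt a 0 ht)
    have he : (fun s : ℝ => s ^ 2 * gW a 1 s) =ᶠ[nhds t]
        (fun s => (a * s + 1) * gW a 0 s) := by
      filter_upwards [lt_mem_nhds ht] with s hs using gW_zero a hs
    have := (hL.congr_of_eventuallyEq he.symm).unique hR
    simp at this ⊢
    linarith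
  | succ j ih =>
    intro t ht
    have hid := hasDerivAt_id t
    have h0 := gW_hasDerivAt a j ht
    have h1 := gW_hasDerivAt a (j + 1) ht
    have h2 := gW_hasDerivAt a (j + 2) ht
    have hL := (((hid.pow 2).mul h2).add ((hid.const_mul (2 * ((j : ℝ) + 1))).mul h1)).add
      (h0.const_mul (((j : ℝ) + 1) * j))
    have hR := (((hid.const_mul a).add_const 1).mul h1).add (h0.const_mul (((j : ℝ) + 1) * a))
    have he : (fun t : ℝ => t ^ 2 * gW a (j + 2) t + 2 * (j + 1) * t * gW a (j + 1) t
        + (j + 1) * j * gW a j t) =ᶠ[nhds t]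
        (fun t => (a * t + 1) * gW a (j + 1) t + (j + 1) * a * gW a j t) := by
      filter_upwards [lt_mem_nhds ht] with s hs using ih hs
    have := (hL.congr_of_eventuallyEq he.symm).unique hR
    simp at this ⊢
    linarith

lemma pre_hasDerivAt (q : ℝ) {t : ℝ} (ht : 0 < t) :
    HasDerivAt (fun y : ℝ => y ^ q * Real.exp (1 / y))
      ((q * t - 1) / t ^ 2 * (t ^ q * Real.exp (1 / t))) t := by
  have h2 : HasDerivAt (fun y : ℝ => y ^ q * Real.exp (1 / y)) (q * t ^ (q - 1) * Real.exp (1 / t) +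
      t ^ q * (Real.exp (1 / t) * (-1 / t ^ 2))) t := by
    refine (Real.hasDerivAt_rpow_const (Or.inl ht.ne')).mul (HasDerivAt.exp ?_)
    have := ((hasDerivAt_const t (1 : ℝ)).div (hasDerivAt_id t) ht.ne')
    exact this.congr_deriv (by simp)
  convert h2 using 1
  rw [Real.rpow_sub_one ht.ne']
  field_simp
  ring

lemma finiteN_eq (q : ℝ) (k : ℕ) :
    finiteN q k = fun x => (-1 : ℝ) ^ k * ((x ^ q * Real.exp (1 / x)) * gW (2 * k - q) k x) := by
  funext x
  simp only [finiteN, gW]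
  ring

lemma finiteN_hasDerivAt (q : ℝ) (k : ℕ) {t : ℝ} (ht : 0 < t) :
    HasDerivAt (finiteN q k) ((-1 : ℝ) ^ k * (((q * t - 1) / t ^ 2 * (t ^ q * Real.exp (1 / t)))
      * gW (2 * k - q) k t + (t ^ q * Real.exp (1 / t)) * gW (2 * k - q) (k + 1) t)) t := by
  rw [finiteN_eq]
  exact ((pre_hasDerivAt q ht).mul (gW_hasDerivAt _ k ht)).const_mul _

lemma finiteN_zero (q : ℝ) {t : ℝ} (ht : 0 < t) : HasDerivAt (finiteN q 0) 0 t := by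
  convert finiteN_hasDerivAt q 0 ht using 1
  have := gW_zero (2 * (0 : ℕ) - q) ht
  have e : gW (2 * (0 : ℕ) - q) 1 t = (-q * t + 1) / t ^ 2 * gW (2 * (0 : ℕ) - q) 0 t := by
    field_simp
    simp at this ⊢
    linarith
  simp only [zero_add]
  rw [e]
  field_simp
  ring

lemma finiteN_succ (q : ℝ) (k : ℕ) {t : ℝ} (ht : 0 < t) :
    HasDerivAt (finiteN q (k + 1)) (((k : ℝ) + 1) * (q - 2 - k) * finiteN (q - 2) k t) t := by
  convert finiteN_hasDerivAt q (k + 1) ht using 1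
  rw [finiteN_eq]
  have hq : 2 * (k : ℝ) - (q - 2) = 2 * ((k + 1 : ℕ) : ℝ) - q := by push_cast; ring
  simp only [hq]
  set a := 2 * ((k + 1 : ℕ) : ℝ) - q with ha
  have h := gW_succ a k ht
  have e : gW a (k + 1 + 1) t = ((a * t + 1) * gW a (k + 1) t + (k + 1) * a * gW a k t
    - 2 * (k + 1) * t * gW a (k + 1) t - (k + 1) * k * gW a k t) / t ^ 2 := by
    field_simp
    linarith
  have e2 : t ^ (q - 2) = t ^ q / t ^ 2 := by
    rw [Real.rpow_sub ht]; norm_num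
  rw [e, e2, ha]
  push_cast
  field_simp
  ring

/-- ODE package. -/
lemma finiteN_ode (q : ℝ) (k : ℕ) : ∃ D D2 : ℝ → ℝ, ∀ t : ℝ, 0 < t →
    HasDerivAt (finiteN q k) (D t) t ∧ HasDerivAt D (D2 t) t ∧
    t ^ 2 * D2 t + (2 - q) * t * D t + D t = k * (k + 1 - q) * finiteN q k t ∧
    D t = k * (q - 1 - k) * (if k = 0 then 0 else finiteN (q - 2) (k - 1) t) := by
  cases k with
  | zero =>
    refine ⟨fun _ => 0, fun _ => 0, fun t ht => ⟨finiteN_zero q ht, hasDerivAt_const _ _, ?_, ?_⟩⟩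
      <;> simp
  | succ k =>
    refine ⟨fun t => ((k : ℝ) + 1) * (q - 2 - k) * finiteN (q - 2) k t, _,
      fun t ht => ⟨finiteN_succ q k ht, (finiteN_hasDerivAt (q - 2) k ht).const_mul _, ?_, ?_⟩⟩
    · simp only [finiteN_eq]
      have hq : 2 * (k : ℝ) - (q - 2) = 2 * ((k + 1 : ℕ) : ℝ) - q := by push_cast; ring
      simp only [hq]
      have e2 : t ^ (q - 2) = t ^ q / t ^ 2 := by
        rw [Real.rpow_sub ht]; norm_num
      rw [e2]
      push_cast
      field_simp
      ring
    · simp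
      left; left; ring

lemma xgrad_eq {d : ℕ} (f : (Fin d → ℝ) → ℝ) (x : Fin d → ℝ) : xgrad f x = fderiv ℝ f x x := by
  unfold xgrad pdx
  conv_rhs => rw [← Finset.univ_sum_single x]
  rw [map_sum]
  rw [Finset.univ_sum_single x]
  refine Finset.sum_congr rfl fun i _ => ?_
  rw [← smul_eq_mul, ← map_smul]
  congr 1
  rw [← Pi.single_smul]
  simp

lemma xgrad_lin {d : ℕ} (f g : (Fin d → ℝ) → ℝ) (hf : Differentiable ℝ f) (hg : Differentiable ℝ g)
    (a b : ℝ) (x : Fin d → ℝ) :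
    xgrad (fun y => a * f y + b * g y) x = a * xgrad f x + b * xgrad g x := by
  simp only [xgrad_eq]
  have := (((hf x).hasFDerivAt.const_mul a).add ((hg x).hasFDerivAt.const_mul b)).fderiv
  erw [this]
  simp

lemma euler {d : ℕ} (K : (Fin d → ℝ) → ℝ → ℝ)
    (hK : Differentiable ℝ (fun z : (Fin d → ℝ) × ℝ => K z.1 z.2)) (φ : ℝ → ℝ) (s : ℝ)
    (hφ : HasDerivAt φ s 1) (x : Fin d → ℝ) (t : ℝ)
    (hom : ∀ c : ℝ, 0 < c → K (c • x) (c * t) = φ c * K x t) :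
    xgrad (fun y => K y t) x = s * K x t - t * deriv (K x) t := by
  rw [xgrad_eq]
  set F : (Fin d → ℝ) × ℝ → ℝ := fun z => K z.1 z.2 with hF
  have hL := (hK (x, t)).hasFDerivAt
  have h1 : HasFDerivAt (fun y => K y t) _ x :=
    HasFDerivAt.comp (g := F) (f := fun y => (y, t)) x hL (hasFDerivAt_prodMk_left x t)
  have h2 : HasFDerivAt (K x) _ t :=
    HasFDerivAt.comp (g := F) (f := fun s => (x, s)) t hL (hasFDerivAt_prodMk_right x t)
  have hc : HasDerivAt (fun c : ℝ => ((c • x, c * t) : (Fin d → ℝ) × ℝ)) (x, t) 1 := by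
    have a := (hasDerivAt_id (1 : ℝ)).smul_const x
    have b := (hasDerivAt_id (1 : ℝ)).mul_const t
    simpa using a.prodMk b
  have h3 : HasDerivAt (fun c : ℝ => K (c • x) (c * t)) (fderiv ℝ F (x, t) (x, t)) 1 := by
    refine HasFDerivAt.comp_hasDerivAt (l := F) (f := fun c : ℝ => ((c • x, c * t) : (Fin d → ℝ) × ℝ)) 1 ?_ hc
    simpa using hL
  have h4 := hφ.mul_const (K x t)
  have he : (fun c : ℝ => K (c • x) (c * t)) =ᶠ[nhds 1] (fun c => φ c * K x t) := by
    filter_upwards [lt_mem_nhds one_pos] with c hc using hom c hc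
  have h5 := (h3.congr_of_eventuallyEq he.symm).unique h4
  rw [h1.fderiv, h2.hasDerivAt.deriv, ← h5]
  have : ((x, t) : (Fin d → ℝ) × ℝ) = (x, 0) + t • (0, 1) := by simp
  conv_rhs => enter [1]; rw [show fderiv ℝ F (x, t) (x, t) = fderiv ℝ F (x, t) (x, 0) + t * fderiv ℝ F (x, t) (0, 1) by
    conv_lhs => enter [2]; rw [this]
    rw [map_add, map_smul, smul_eq_mul]]
  simp

theorem stmt9 (d : ℕ) (hd : 1 ≤ d) (μ : ℝ) (hμ : -1/2 < μ) (m n : ℕ) (hmn : m ≤ n) (p : ℝ)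
    (H : (Fin d → ℝ) → ℝ → ℝ)
    (hsmooth : ContDiff ℝ (⊤ : ℕ∞) (fun z : (Fin d → ℝ) × ℝ => H z.1 z.2))
    (hhom : ∀ c : ℝ, 0 < c → ∀ (x : Fin d → ℝ) (t : ℝ), 0 < t →
      H (c • x) (c * t) = c ^ m * H x t)
    (hball : ∀ (x : Fin d → ℝ) (t : ℝ), 0 < t →
      t ^ 2 * lapx (fun y => H y t) x - xgrad (xgrad (fun y => H y t)) x
        - (2 * μ + d - 1) * xgrad (fun y => H y t) x
      = -((m : ℝ) * (m + 2 * μ + d - 1)) * H x t)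
    (v vt : (Fin d → ℝ) → ℝ → ℝ)
    (hv : ∀ (x : Fin d → ℝ) (t : ℝ),
      v x t = finiteN (p - 2 * μ - 2 * m - d + 1) (n - m) t * H x t)
    (hvt : ∀ (x : Fin d → ℝ) (t : ℝ),
      vt x t = if n = m then 0 else finiteN (p - 2 * μ - 2 * m - d - 1) (n - m - 1) t * H x t) :
    ∀ (x : Fin d → ℝ) (t : ℝ), 0 < t →
      t ^ 2 * deriv (deriv (v x)) t
        + (2 * t * xgrad (fun y => deriv (v y) t) x + (1 + 2 * μ + d - p) * t * deriv (v x) t)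
        + (2 * μ + d - p) * xgrad (fun y => v y t) x
        + xgrad (xgrad (fun y => v y t)) x
      = (n : ℝ) * ((n : ℝ) + 2 * μ + d - p) * v x t
        - ((n : ℝ) - m) * (p - 2 * μ - m - n - d) * vt x t := by
  intro x t ht
  set q := p - 2 * μ - 2 * m - d + 1 with hq
  obtain ⟨D, D2, hD⟩ := finiteN_ode q (n - m)
  have hk : ((n - m : ℕ) : ℝ) = (n : ℝ) - m := by push_cast [hmn]; ring
  set f := finiteN q (n - m) with hf
  -- partial derivative of H in t
  set F : (Fin d → ℝ) × ℝ → ℝ := fun z => H z.1 z.2 with hF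
  have hFd : Differentiable ℝ F := hsmooth.differentiable (by simp)
  have hHt : ∀ y s, HasDerivAt (H y) (fderiv ℝ F (y, s) (0, 1)) s := by
    intro y s
    have h2 : HasFDerivAt (H y) _ s :=
      HasFDerivAt.comp (g := F) (f := fun s => (y, s)) s (hFd (y, s)).hasFDerivAt (hasFDerivAt_prodMk_right y s)
    simpa using h2.hasDerivAt
  set Ht : (Fin d → ℝ) → ℝ → ℝ := fun y s => fderiv ℝ F (y, s) (0, 1) with hHtdef
  have hHtd : Differentiable ℝ (fun z : (Fin d → ℝ) × ℝ => Ht z.1 z.2) := by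
    have h1 : ContDiff ℝ 1 (fun z : (Fin d → ℝ) × ℝ => Ht z.1 z.2) :=
      (hsmooth.fderiv_right (m := 1) (by norm_cast)).clm_apply contDiff_const
    exact h1.differentiable (by simp)
  have hHtt : ∀ y s, DifferentiableAt ℝ (Ht y) s := fun y s =>
    DifferentiableAt.comp (g := fun z : (Fin d → ℝ) × ℝ => Ht z.1 z.2) (f := fun s => (y, s)) s (hHtd (y, s)) (hasFDerivAt_prodMk_right y s).differentiableAt
  have hHx : ∀ s, Differentiable ℝ (fun y => H y s) := fun s y =>
    DifferentiableAt.comp (g := F) (f := fun y => (y, s)) y (hFd (y, s)) (hasFDerivAt_prodMk_left y s).differentiableAt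
  have hHtx : ∀ s, Differentiable ℝ (fun y => Ht y s) := fun s y =>
    DifferentiableAt.comp (g := fun z : (Fin d → ℝ) × ℝ => Ht z.1 z.2) (f := fun y => (y, s)) y (hHtd (y, s)) (hasFDerivAt_prodMk_left y s).differentiableAt
  have hHthom : ∀ c : ℝ, 0 < c → ∀ (y : Fin d → ℝ) (s : ℝ), 0 < s →
      Ht (c • y) (c * s) = c ^ m * c⁻¹ * Ht y s := by
    intro c hc y s hs
    have h1 : HasDerivAt (fun r => H (c • y) (c * r)) (Ht (c • y) (c * s) * (c * 1)) s :=
      (hHt (c • y) (c * s)).comp s ((hasDerivAt_id s).const_mul c)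
    have h2 := (hHt y s).const_mul (c ^ m)
    have he : (fun r => H (c • y) (c * r)) =ᶠ[nhds s] (fun r => c ^ m * H y r) := by
      filter_upwards [lt_mem_nhds hs] with r hr using hhom c hc y r hr
    have h3 := (h1.congr_of_eventuallyEq he.symm).unique h2
    field_simp
    linarith
  have hE1 : ∀ y, xgrad (fun y => H y t) y = m * H y t - t * Ht y t := by
    intro y
    have hφ : HasDerivAt (fun c : ℝ => c ^ m) (m : ℝ) 1 := by
      simpa using hasDerivAt_pow m (1 : ℝ)
    rw [euler H hFd _ _ hφ y t (fun c hc => hhom c hc y t ht), (hHt y t).deriv]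
  have hE2 : xgrad (fun y => Ht y t) x = (m - 1) * Ht x t - t * deriv (Ht x) t := by
    have hφ : HasDerivAt (fun c : ℝ => c ^ m * c⁻¹) ((m : ℝ) - 1) 1 := by
      have := (hasDerivAt_pow m (1 : ℝ)).mul (hasDerivAt_inv (one_ne_zero (α := ℝ)))
      exact this.congr_deriv (by simp; ring)
    rw [euler Ht hHtd _ _ hφ x t (fun c hc => hHthom c hc x t ht)]
  have hv' : ∀ y, v y = fun s => f s * H y s := fun y => funext fun s => hv y s
  have hdv : ∀ y s, 0 < s → deriv (v y) s = D s * H y s + f s * Ht y s := by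
    intro y s hs
    rw [hv' y]
    exact ((hD s hs).1.mul (hHt y s)).deriv
  have hddv : deriv (deriv (v x)) t = (D2 t * H x t + D t * Ht x t)
      + (D t * Ht x t + f t * deriv (Ht x) t) := by
    have he : deriv (v x) =ᶠ[nhds t] (fun s => D s * H x s + f s * Ht x s) := by
      filter_upwards [lt_mem_nhds ht] with s hs using hdv x s hs
    rw [he.deriv_eq]
    exact (((hD t ht).2.1.mul (hHt x t)).add ((hD t ht).1.mul (hHtt x t).hasDerivAt)).deriv
  have hx1 : xgrad (fun y => deriv (v y) t) x
      = D t * xgrad (fun y => H y t) x + f t * xgrad (fun y => Ht y t) x := by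
    rw [show (fun y => deriv (v y) t) = fun y => D t * H y t + f t * Ht y t from
      funext fun y => hdv y t ht]
    exact xgrad_lin _ _ (hHx t) (hHtx t) _ _ _
  have hx2 : xgrad (fun y => v y t) = fun y => (f t * m) * H y t + (-(f t * t)) * Ht y t := by
    funext y
    rw [show (fun y => v y t) = fun y => f t * H y t + 0 * H y t from
      funext fun y => by rw [hv]; ring]
    rw [xgrad_lin _ _ (hHx t) (hHx t), hE1]
    ring
  have hx3 := xgrad_lin _ _ (hHx t) (hHtx t) (f t * m) (-(f t * t)) x
  rw [hx1, hx2, hx3, hddv, hdv x t ht, hE1, hE2]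
  obtain ⟨-, -, ho1, ho2⟩ := hD t ht
  have hvt' : ((n : ℝ) - m) * (p - 2 * μ - m - n - d) * vt x t = D t * H x t := by
    rw [ho2, hvt, hk]
    have hq2 : q - 2 = p - 2 * μ - 2 * m - d - 1 := by rw [hq]; ring
    by_cases h : n = m
    · simp [h]
    · have h' : n - m ≠ 0 := by omega
      rw [if_neg h, if_neg h', hq2, hq]
      ring
  rw [hvt', hv x t]
  rw [hk] at ho1
  have ho3 : t ^ 2 * D2 t = ((n : ℝ) - m) * (n - m + 1 - q) * f t - (2 - q) * t * D t - D t := by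
    linarith
  rw [hq] at ho3
  linear_combination (H x t) * ho3
end
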